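/- Let A and A' be automata with no stuck states. Then the sequenced pre-product of A and A' is weakly adequate. -/

import Mathlib

/-- An automaton: distinct initial and final controls, and a transition relation on
states (control–store pairs) satisfying finality and non-stuttering. -/
structure Automaton (Ctrl : Type*) (Sto : Type*) where
  init : Ctrl
  fin : Ctrl
  init_ne_fin : init ≠ fin
  step : Ctrl × Sto → Ctrl × Sto → Prop
  finality : ∀ {γ β : Ctrl × Sto}, step γ β → γ.1 ≠ fin
  nonstutter : ∀ {γ β : Ctrl × Sto}, step γ β → γ.1 ≠ β.1

variable {Ctrl Sto Ctrl' Sto' : Type*}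

/-- A trace: a nonempty finite sequence of states, consecutive under the transition
relation, whose first state has control `init`. -/
def Automaton.IsTrace (A : Automaton Ctrl Sto) (τ : List (Ctrl × Sto)) : Prop :=
  τ ≠ [] ∧ List.Chain' A.step τ ∧ ∀ h : τ ≠ [], (τ.head h).1 = A.init

/-- A terminated trace: a trace whose last state has control `fin`. -/
def Automaton.IsTerminated (A : Automaton Ctrl Sto) (τ : List (Ctrl × Sto)) : Prop :=
  A.IsTrace τ ∧ ∀ h : τ ≠ [], (τ.getLast h).1 = A.fin

/-- A finite trace satisfies the spec ⟨P,Q⟩ in the basic semantics. -/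
def Automaton.TraceSat (A : Automaton Ctrl Sto) (P Q : Sto → Prop)
    (τ : List (Ctrl × Sto)) : Prop :=
  ∀ h : τ ≠ [], P (τ.head h).2 → (τ.getLast h).1 = A.fin → Q (τ.getLast h).2

/-- An automaton satisfies the spec ⟨P,Q⟩ (basic semantics) iff all its finite traces do. -/
def Automaton.Sat (A : Automaton Ctrl Sto) (P Q : Sto → Prop) : Prop :=
  ∀ τ, A.IsTrace τ → A.TraceSat P Q τ

/-- Traces τ of A and τ' of A' satisfy the relational spec ⟨R,S⟩. -/
def RelTraceSat (A : Automaton Ctrl Sto) (A' : Automaton Ctrl' Sto')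
    (R S : Sto → Sto' → Prop)
    (τ : List (Ctrl × Sto)) (τ' : List (Ctrl' × Sto')) : Prop :=
  ∀ (h : τ ≠ []) (h' : τ' ≠ []),
    R (τ.head h).2 (τ'.head h').2 →
    (τ.getLast h).1 = A.fin → (τ'.getLast h').1 = A'.fin →
    S (τ.getLast h).2 (τ'.getLast h').2

/-- The pair A, A' satisfies the relational spec ⟨R,S⟩ iff all pairs of finite traces do. -/
def RelSat (A : Automaton Ctrl Sto) (A' : Automaton Ctrl' Sto')
    (R S : Sto → Sto' → Prop) : Prop :=
  ∀ τ τ', A.IsTrace τ → A'.IsTrace τ' → RelTraceSat A A' R S τ τ'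

/-- Remove from a list each element equal to its immediate predecessor. -/
noncomputable def destutter {α : Type*} (l : List α) : List α :=
  letI : DecidableRel (α := α) (· ≠ ·) := fun _ _ => Classical.propDecidable _
  List.destutter (· ≠ ·) l

/-- The A-state component of a state of a product of A and A'. -/
def leftSt (γ : (Ctrl × Ctrl') × (Sto × Sto')) : Ctrl × Sto := (γ.1.1, γ.2.1)

/-- The A'-state component of a state of a product of A and A'. -/
def rightSt (γ : (Ctrl × Ctrl') × (Sto × Sto')) : Ctrl' × Sto' := (γ.1.2, γ.2.2)

/-- left(T) = destutter (map fst T). -/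
noncomputable def leftTrace (T : List ((Ctrl × Ctrl') × (Sto × Sto'))) :
    List (Ctrl × Sto) :=
  destutter (T.map leftSt)

/-- right(T) = destutter (map snd T). -/
noncomputable def rightTrace (T : List ((Ctrl × Ctrl') × (Sto × Sto'))) :
    List (Ctrl' × Sto') :=
  destutter (T.map rightSt)

/-- P is a pre-product of A and A': an automaton on control set Ctrl × Ctrl' and
store set Sto × Sto', with initial control (init, init'), final control (fin, fin'),
whose transition relation is contained in (↦ ⊗ ↦') ∪ (↦ ⊗ id) ∪ (id ⊗ ↦'). -/
def IsPreProduct (A : Automaton Ctrl Sto) (A' : Automaton Ctrl' Sto')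
    (P : Automaton (Ctrl × Ctrl') (Sto × Sto')) : Prop :=
  P.init = (A.init, A'.init) ∧ P.fin = (A.fin, A'.fin) ∧
  ∀ γ β, P.step γ β →
    (A.step (leftSt γ) (leftSt β) ∧ A'.step (rightSt γ) (rightSt β)) ∨
    (A.step (leftSt γ) (leftSt β) ∧ rightSt γ = rightSt β) ∨
    (leftSt γ = leftSt β ∧ A'.step (rightSt γ) (rightSt β))

/-- Adequacy: every pair of finite traces of A and A' is covered by some trace of P. -/
def Adequate (A : Automaton Ctrl Sto) (A' : Automaton Ctrl' Sto')
    (P : Automaton (Ctrl × Ctrl') (Sto × Sto')) : Prop :=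
  ∀ τ τ', A.IsTrace τ → A'.IsTrace τ' →
    ∃ T, P.IsTrace T ∧ τ <+: leftTrace T ∧ τ' <+: rightTrace T

/-- Weak adequacy: every pair of finite prefixes of terminated traces of A and A'
(that are themselves traces) is covered by some trace of P. -/
def WeaklyAdequate (A : Automaton Ctrl Sto) (A' : Automaton Ctrl' Sto')
    (P : Automaton (Ctrl × Ctrl') (Sto × Sto')) : Prop :=
  ∀ τ τ', A.IsTrace τ → A'.IsTrace τ' →
    (∃ σ, A.IsTerminated σ ∧ τ <+: σ) →
    (∃ σ', A'.IsTerminated σ' ∧ τ' <+: σ') →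
    ∃ T, P.IsTrace T ∧ τ <+: leftTrace T ∧ τ' <+: rightTrace T

/-- No stuck states: every state whose control is not fin has a successor. -/
def NoStuck (A : Automaton Ctrl Sto) : Prop :=
  ∀ γ : Ctrl × Sto, γ.1 ≠ A.fin → ∃ β, A.step γ β

/-- Only-lockstep transitions: both sides step. -/
def lockstepStep (A : Automaton Ctrl Sto) (A' : Automaton Ctrl' Sto')
    (γ β : (Ctrl × Ctrl') × (Sto × Sto')) : Prop :=
  A.step (leftSt γ) (leftSt β) ∧ A'.step (rightSt γ) (rightSt β)

/-- Interleaved transitions: exactly one side steps. -/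
def interleavedStep (A : Automaton Ctrl Sto) (A' : Automaton Ctrl' Sto')
    (γ β : (Ctrl × Ctrl') × (Sto × Sto')) : Prop :=
  (A.step (leftSt γ) (leftSt β) ∧ rightSt γ = rightSt β) ∨
  (leftSt γ = leftSt β ∧ A'.step (rightSt γ) (rightSt β))

/-- The sequenced pre-product automaton. -/
def Automaton.sequenced (A : Automaton Ctrl Sto) (A' : Automaton Ctrl' Sto') :
    Automaton (Ctrl × Ctrl') (Sto × Sto') where
  init := (A.init, A'.init)
  fin := (A.fin, A'.fin)
  init_ne_fin := fun h => A.init_ne_fin (congrArg Prod.fst h)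
  step γ β :=
    (A.step (leftSt γ) (leftSt β) ∧ (rightSt γ).1 = A'.init ∧ rightSt γ = rightSt β) ∨
    ((leftSt γ).1 = A.fin ∧ leftSt γ = leftSt β ∧ A'.step (rightSt γ) (rightSt β))
  finality := by
    intro γ β h e
    rcases h with ⟨h, -, -⟩ | ⟨-, -, h⟩
    · exact A.finality h (show γ.1.1 = A.fin by rw [e])
    · exact A'.finality h (show γ.1.2 = A'.fin by rw [e])
  nonstutter := by
    intro γ β h e
    rcases h with ⟨h, -, -⟩ | ⟨-, -, h⟩
    · exact A.nonstutter h (show γ.1.1 = β.1.1 by rw [e])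
    · exact A'.nonstutter h (show γ.1.2 = β.1.2 by rw [e])

/-- The product state with given components. -/
def pairSt (γ : Ctrl × Sto) (γ' : Ctrl' × Sto') : (Ctrl × Ctrl') × (Sto × Sto') :=
  ((γ.1, γ'.1), (γ.2, γ'.2))

theorem leftSt_pairSt (γ : Ctrl × Sto) (γ' : Ctrl' × Sto') : leftSt (pairSt γ γ') = γ := rfl

theorem rightSt_pairSt (γ : Ctrl × Sto) (γ' : Ctrl' × Sto') : rightSt (pairSt γ γ') = γ' := rfl

theorem destutter_append_replicate_getLast {α : Type*} (a : α) (l : List α) (n : ℕ)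
    (hl : List.IsChain (· ≠ ·) (a :: l)) :
    destutter ((a :: l) ++ List.replicate n ((a :: l).getLast (by simp))) = a :: l := by
  unfold destutter
  simp only [List.cons_append, List.destutter_cons']
  induction l generalizing a with
  | nil =>
    induction n with
    | zero => rfl
    | succ n ih => simpa [List.replicate_succ, List.destutter'] using ih
  | cons b l ih =>
    rw [List.isChain_cons_cons] at hl
    simpa [List.destutter', hl.1] using ih b hl.2

theorem destutter_replicate_append {α : Type*} (a : α) (l : List α) (n : ℕ)
    (hl : List.IsChain (· ≠ ·) (a :: l)) :
    destutter (List.replicate (n + 1) a ++ l) = a :: l := by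
  unfold destutter
  simp only [List.replicate_succ, List.cons_append, List.destutter_cons']
  induction n with
  | zero =>
    let _ : DecidableRel (α := α) (· ≠ ·) := fun _ _ => Classical.propDecidable _
    exact List.destutter'_of_isChain_cons l (· ≠ ·) hl
  | succ n ih => simpa [List.replicate_succ, List.destutter'] using ih

theorem Automaton.isChain_ne (A : Automaton Ctrl Sto) {τ : List (Ctrl × Sto)}
    (h : List.IsChain A.step τ) : List.IsChain (· ≠ ·) τ :=
  h.imp fun _ _ hs e => A.nonstutter hs (congrArg Prod.fst e)

/-- If A and A' have no stuck states then their sequenced pre-product is weakly adequate. -/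
theorem sequenced_weaklyAdequate
    (A : Automaton Ctrl Sto) (A' : Automaton Ctrl' Sto')
    (hA : NoStuck A) (hA' : NoStuck A') :
    WeaklyAdequate A A' (A.sequenced A') := by
  rintro τ τ' - - ⟨σ, ⟨⟨hne, hc, hi⟩, hf⟩, hτ⟩ ⟨σ', ⟨⟨hne', hc', hi'⟩, -⟩, hτ'⟩
  obtain ⟨a, l, rfl⟩ := List.exists_cons_of_ne_nil hne
  obtain ⟨a', l', rfl⟩ := List.exists_cons_of_ne_nil hne'
  have hc : List.IsChain A.step (a :: l) := hc
  have hc' : List.IsChain A'.step (a' :: l') := hc'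
  have hi : a.1 = A.init := hi hne
  have hi' : a'.1 = A'.init := hi' hne'
  have hf := hf hne
  set z := (a :: l).getLast hne
  refine ⟨(a :: l).map (pairSt · a') ++ l'.map (pairSt z), ⟨by simp, ?_, ?_⟩, ?_, ?_⟩
  · change List.IsChain _ _
    refine List.isChain_append.2 ⟨?_, ?_, ?_⟩
    · rw [List.isChain_map]
      exact hc.imp fun _ _ hs => Or.inl ⟨hs, hi', rfl⟩
    · rw [List.isChain_map]
      exact hc'.tail.imp fun _ _ hs => Or.inr ⟨hf, rfl, hs⟩
    · intro x hx y hy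
      rw [List.getLast?_map, List.getLast?_eq_some_getLast hne] at hx
      cases l' with
      | nil => simp at hy
      | cons b l' =>
        simp only [Option.map_some, Option.mem_def, Option.some.injEq, List.map_cons,
          List.head?_cons] at hx hy
        subst hx hy
        exact Or.inr ⟨hf, rfl, (List.isChain_cons_cons.1 hc').1⟩
  · intro _
    exact Prod.ext hi hi'
  · convert hτ using 1
    have h := destutter_append_replicate_getLast a l l'.length (A.isChain_ne hc)
    simpa [leftTrace, Function.comp_def, leftSt_pairSt] using h
  · convert hτ' using 1
    have h := destutter_replicate_append a' l' l.length (A'.isChain_ne hc')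
    simpa [rightTrace, Function.comp_def, rightSt_pairSt, List.replicate_succ] using h
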